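/- Let L ⊆ ℤ[x]^2 be the ℤ[x]-lattice generated by the single element (x^2 + 1 − x, x − 1). Then the lattice σ-ideal I_L ⊆ K{y_1, y_2} is a σ-prime σ-ideal, and I_L = ⟨y_1^{x^2+1} y_2^x − y_1^x y_2, y_1^{x^3+1} y_2^{x^2} − y_2⟩_r. -/

import Mathlib

open Polynomial

section SigmaRing

variable {R : Type*} [CommRing R]

/-- A σ-ideal: an ideal closed under the difference operator σ. -/
def IsSigmaIdeal (σ : R →+* R) (I : Ideal R) : Prop := ∀ a ∈ I, σ a ∈ I

/-- A σ-ideal is well-mixed if `a * b ∈ I` implies `a * σ b ∈ I`. -/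
def IsWellMixed (σ : R →+* R) (I : Ideal R) : Prop := ∀ a b : R, a * b ∈ I → a * σ b ∈ I

/-- `[F]`, the smallest σ-ideal containing `F`. -/
def sigmaIdealGen (σ : R →+* R) (F : Set R) : Ideal R :=
  sInf {I : Ideal R | F ⊆ I ∧ IsSigmaIdeal σ I}

/-- `⟨F⟩`, the smallest well-mixed σ-ideal containing `F` (well-mixed closure). -/
def wmClosure (σ : R →+* R) (F : Set R) : Ideal R :=
  sInf {I : Ideal R | F ⊆ I ∧ IsSigmaIdeal σ I ∧ IsWellMixed σ I}

/-- `⟨F⟩_r`, the smallest radical well-mixed σ-ideal containing `F`. -/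
def rwmClosure (σ : R →+* R) (F : Set R) : Ideal R :=
  sInf {I : Ideal R | F ⊆ I ∧ IsSigmaIdeal σ I ∧ IsWellMixed σ I ∧ I.IsRadical}

/-- Symbolic exponent: for `p = Σ c_i x^i ∈ ℕ[x]`, `a^p = Π (σ^i a)^(c_i)`. -/
noncomputable def sexp (σ : R →+* R) (a : R) (p : Polynomial ℕ) : R :=
  ∏ i ∈ Finset.range (p.natDegree + 1), ((⇑σ)^[i] a) ^ (p.coeff i)

/-- `I` is finitely generated as a radical well-mixed σ-ideal. -/
def FinGenAsRWM (σ : R →+* R) (I : Ideal R) : Prop :=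
  ∃ G : Set R, G.Finite ∧ G ⊆ (I : Set R) ∧ I = rwmClosure σ G

/-- σ-prime: a reflexive σ-ideal which is prime. -/
def IsSigmaPrime (σ : R →+* R) (I : Ideal R) : Prop :=
  IsSigmaIdeal σ I ∧ (∀ a : R, σ a ∈ I → a ∈ I) ∧ I.IsPrime

end SigmaRing

/-- The σ-polynomial ring `K{y_1,…,y_n}`: polynomials in variables `y_i^{x^j}`,
indexed by pairs `(i, j) ∈ Fin n × ℕ`. -/
abbrev DPoly (K : Type*) [Field K] (n : ℕ) := MvPolynomial (Fin n × ℕ) K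

section DPoly

variable {K : Type*} [Field K] {n : ℕ} (σK : K →+* K)

/-- The difference operator on `K{y_1,…,y_n}` extending `σK`, with `σ(y_i^{x^j}) = y_i^{x^{j+1}}`. -/
noncomputable def shift : DPoly K n →+* DPoly K n :=
  MvPolynomial.eval₂Hom ((MvPolynomial.C : K →+* DPoly K n).comp σK)
    (fun v => MvPolynomial.X (v.1, v.2 + 1))

/-- `y_i^p` for `p ∈ ℕ[x]`. -/
noncomputable def ypow (i : Fin n) (p : Polynomial ℕ) : DPoly K n :=
  sexp (shift σK) (MvPolynomial.X (i, 0)) p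

/-- `y_i^{x^a}`. -/
noncomputable def varPow (i : Fin n) (a : ℕ) : DPoly K n :=
  ypow σK i (Polynomial.X ^ a)

/-- The monomial `Y^f = Π y_i^{f_i}` for `f ∈ ℕ[x]^n`. -/
noncomputable def monom (f : Fin n → Polynomial ℕ) : DPoly K n :=
  ∏ i, ypow σK i (f i)

/-- A pure binomial `Y^f − Y^g`. -/
def IsPureBinomial (p : DPoly K n) : Prop :=
  ∃ f g : Fin n → Polynomial ℕ, p = monom σK f - monom σK g

/-- A binomial `a·Y^f + b·Y^g` with `a, b ∈ K^×`. -/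
def IsBinomial (p : DPoly K n) : Prop :=
  ∃ (a b : K) (f g : Fin n → Polynomial ℕ), a ≠ 0 ∧ b ≠ 0 ∧
    p = MvPolynomial.C a * monom σK f + MvPolynomial.C b * monom σK g

/-- A pure binomial σ-ideal: a σ-ideal generated by pure binomials. -/
def IsPureBinomialSigmaIdeal (I : Ideal (DPoly K n)) : Prop :=
  ∃ S : Set (DPoly K n), (∀ p ∈ S, IsPureBinomial σK p) ∧ I = sigmaIdealGen (shift σK) S

/-- Positive part of `f ∈ ℤ[x]`. -/
noncomputable def posPart (f : Polynomial ℤ) : Polynomial ℕ :=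
  f.sum fun i c => Polynomial.monomial i c.toNat

/-- Negative part of `f ∈ ℤ[x]`. -/
noncomputable def negPart (f : Polynomial ℤ) : Polynomial ℕ :=
  f.sum fun i c => Polynomial.monomial i (-c).toNat

/-- The lattice σ-ideal `I_L = [Y^{f_+} − Y^{f_−} : f ∈ L]` of a ℤ[x]-lattice `L ⊆ ℤ[x]^n`. -/
noncomputable def latticeIdeal (L : Submodule (Polynomial ℤ) (Fin n → Polynomial ℤ)) :
    Ideal (DPoly K n) :=
  sigmaIdealGen (shift σK)
    {p | ∃ f ∈ L, p = monom σK (fun i => posPart (f i)) - monom σK (fun i => negPart (f i))}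

end DPoly

/-- `𝔪`: the multiplicatively closed set generated by the variables `y_i^{x^j}`. -/
def mSet (K : Type*) [Field K] (n : ℕ) : Set (DPoly K n) :=
  (Submonoid.closure (Set.range fun v : Fin n × ℕ => (MvPolynomial.X v : DPoly K n)) : Set _)

/-- `I : 𝔪 = {p : M p ∈ I for some M ∈ 𝔪}`. -/
def colonM {K : Type*} [Field K] {n : ℕ} (I : Ideal (DPoly K n)) : Set (DPoly K n) :=
  {p | ∃ M ∈ mSet K n, M * p ∈ I}

section Tsec

variable {K : Type*} [Field K] {n t : ℕ} (σK : K →+* K)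

/-- The set `T^{a_1…a_t}_{j_1…j_t}` of monomials `Y^f` with `deg f_{j_i} < a_i`. -/
def Tset (j : Fin t → Fin n) (a : Fin t → ℕ) : Set (DPoly K n) :=
  {p | ∃ f : Fin n → Polynomial ℕ,
    (∀ i : Fin t, (f (j i)).degree < (a i : WithBot ℕ)) ∧ p = monom σK f}

/-- `I` is saturated with respect to `{y_{j_1}^{x^{a_1}},…,y_{j_t}^{x^{a_t}}}`. -/
def SaturatedWrt (j : Fin t → Fin n) (a : Fin t → ℕ) (I : Ideal (DPoly K n)) : Prop :=
  ∀ g M : DPoly K n, M ∈ Tset σK j a → M * g ∈ I → g ∈ I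

/-- `J : T = {g : M g ∈ J for some M ∈ T}`. -/
def colonT (j : Fin t → Fin n) (a : Fin t → ℕ) (J : Ideal (DPoly K n)) : Set (DPoly K n) :=
  {g | ∃ M ∈ Tset σK j a, M * g ∈ J}

/-- The `T`-saturated closure `N^{a_1…a_t}_{j_1…j_t}(I)`: the smallest saturated σ-ideal
containing `I`. -/
noncomputable def Nclosure (j : Fin t → Fin n) (a : Fin t → ℕ) (I : Ideal (DPoly K n)) :
    Ideal (DPoly K n) :=
  sInf {J : Ideal (DPoly K n) | I ≤ J ∧ IsSigmaIdeal (shift σK) J ∧ SaturatedWrt σK j a J}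

/-- The set of variables `{y_{j_1}^{x^{a_1}},…,y_{j_t}^{x^{a_t}}}`. -/
noncomputable def varSet (j : Fin t → Fin n) (a : Fin t → ℕ) : Set (DPoly K n) :=
  Set.range fun i => varPow σK (j i) (a i)

/-- `⟨I₀ ∪ {y_{j_1}^{x^{a_1}},…,y_{j_t}^{x^{a_t}}}⟩_r` is quasi-normal. -/
def QuasiNormal (j : Fin t → Fin n) (a : Fin t → ℕ) (I0 : Ideal (DPoly K n)) : Prop :=
  SaturatedWrt σK j a I0 ∧
  ∀ f g : Fin n → Polynomial ℕ, monom σK f - monom σK g ∈ I0 →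
    monom σK f ∈ sigmaIdealGen (shift σK) (varSet σK j a) →
    monom σK g ∈ sigmaIdealGen (shift σK) (varSet σK j a)

end Tsec

section RadicalWellMixed

variable {R : Type*} [CommRing R]

theorem exists_notMem_mul_pow_mem_of_mem_minimalPrimes {I P : Ideal R}
    (hP : P ∈ I.minimalPrimes) {x : R} (hx : x ∈ P) : ∃ s ∉ P, ∃ n : ℕ, s * x ^ n ∈ I := by
  have := hP.1.1
  by_contra! H
  obtain ⟨Q, hQ, hIQ, hQd⟩ := Ideal.exists_le_prime_disjoint I
    (P.primeCompl ⊔ Submonoid.powers x) (by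
      rw [Set.disjoint_left]
      rintro a ha hS
      obtain ⟨s, hs, _, ⟨n, rfl⟩, rfl⟩ := Submonoid.mem_sup.1 hS
      exact H s hs n ha)
  rw [Set.disjoint_left] at hQd
  have hQP : Q ≤ P := fun a ha => by
    by_contra haP
    exact hQd ha (Submonoid.mem_sup_left (show a ∈ P.primeCompl from haP))
  exact hQd (hP.2 ⟨hQ, hIQ⟩ hQP hx) (Submonoid.mem_sup_right (Submonoid.mem_powers x))

/-- The minimal primes over a radical well-mixed ideal are σ-ideals. -/
theorem IsWellMixed.isSigmaIdeal_of_mem_minimalPrimes {σ : R →+* R} {I P : Ideal R}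
    (hI : IsWellMixed σ I) (hr : I.IsRadical) (hP : P ∈ I.minimalPrimes) :
    IsSigmaIdeal σ P := by
  have hprime := hP.1.1
  intro a ha
  obtain ⟨s, hs, n, h⟩ := exists_notMem_mul_pow_mem_of_mem_minimalPrimes hP ha
  have hsa : s * a ∈ I := hr ⟨n + 1, by
    have := I.mul_mem_left (s ^ n * a) h
    convert this using 1
    ring⟩
  exact (hprime.mem_or_mem (hP.1.2 (hI s a hsa))).resolve_left hs

/-- A radical well-mixed closure is the intersection of the prime σ-ideals above it. -/
theorem le_rwmClosure {σ : R →+* R} {F : Set R} {I : Ideal R}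
    (h : ∀ P : Ideal R, P.IsPrime → IsSigmaIdeal σ P → F ⊆ P → I ≤ P) :
    I ≤ rwmClosure σ F := by
  refine le_sInf ?_
  rintro J ⟨hF, -, hwm, hr⟩
  rw [← hr.radical, ← Ideal.sInf_minimalPrimes]
  exact le_sInf fun P hP => h P hP.1.1 (hwm.isSigmaIdeal_of_mem_minimalPrimes hr hP)
    (hF.trans hP.1.2)

theorem IsSigmaPrime.rwmClosure_le {σ : R →+* R} {F : Set R} {I : Ideal R}
    (hI : IsSigmaPrime σ I) (hF : F ⊆ I) : rwmClosure σ F ≤ I := by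
  refine sInf_le ⟨hF, hI.1, fun a b hab => ?_, hI.2.2.isRadical⟩
  rcases hI.2.2.mem_or_mem hab with h | h
  · exact I.mul_mem_right _ h
  · exact I.mul_mem_left _ (hI.1 b h)

theorem subset_sigmaIdealGen (σ : R →+* R) (F : Set R) : F ⊆ sigmaIdealGen σ F :=
  fun _ ha => Submodule.mem_sInf.2 fun _ hI => hI.1 ha

theorem sigmaIdealGen_le {σ : R →+* R} {F : Set R} {I : Ideal R} (hF : F ⊆ I)
    (hI : IsSigmaIdeal σ I) : sigmaIdealGen σ F ≤ I :=
  sInf_le ⟨hF, hI⟩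

end RadicalWellMixed

section Monomials

variable {K : Type*} [Field K] {n : ℕ} (σK : K →+* K)

theorem shift_X (v : Fin n × ℕ) :
    shift σK (MvPolynomial.X v : DPoly K n) = MvPolynomial.X (v.1, v.2 + 1) := by
  simp [shift]

theorem shift_iterate_X (i : Fin n) (k j : ℕ) :
    (shift σK)^[k] (MvPolynomial.X (i, j) : DPoly K n) = MvPolynomial.X (i, j + k) := by
  induction k generalizing j with
  | zero => rfl
  | succ k ih => rw [Function.iterate_succ_apply, shift_X, ih]; congr 2; omega

theorem ypow_eq_prod (i : Fin n) (p : ℕ[X]) {N : ℕ} (hN : p.natDegree < N) :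
    ypow σK i p = ∏ j ∈ Finset.range N, (MvPolynomial.X (i, j) : DPoly K n) ^ p.coeff j := by
  rw [ypow, sexp]
  simp only [shift_iterate_X, zero_add]
  refine Finset.prod_subset (Finset.range_mono hN) fun j _ hj => ?_
  rw [Polynomial.coeff_eq_zero_of_natDegree_lt (by simpa using hj), pow_zero]

theorem ypow_add (i : Fin n) (p q : ℕ[X]) :
    ypow σK i (p + q) = ypow σK i p * ypow σK i q := by
  have h := Polynomial.natDegree_add_le p q
  rw [ypow_eq_prod σK i (p + q) (N := max p.natDegree q.natDegree + 1) (by omega),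
    ypow_eq_prod σK i p (N := max p.natDegree q.natDegree + 1) (by omega),
    ypow_eq_prod σK i q (N := max p.natDegree q.natDegree + 1) (by omega),
    ← Finset.prod_mul_distrib]
  simp only [Polynomial.coeff_add, pow_add]

theorem ypow_zero (i : Fin n) : ypow σK i 0 = 1 := by
  simp [ypow, sexp]

theorem ypow_X_pow (i : Fin n) (j : ℕ) :
    ypow σK i (Polynomial.X ^ j) = MvPolynomial.X (i, j) := by
  rw [ypow_eq_prod σK i (X ^ j) (N := j + 1) (by simp), Finset.prod_eq_single j]
  · simp
  · intro k _ hk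
    simp [Polynomial.coeff_X_pow, hk]
  · simp

theorem X_dvd_ypow (i : Fin n) {p : ℕ[X]} {j : ℕ} (hj : p.coeff j ≠ 0) :
    (MvPolynomial.X (i, j) : DPoly K n) ∣ ypow σK i p := by
  rw [ypow_eq_prod σK i p (Nat.lt_succ_self _)]
  exact (dvd_pow_self _ hj).trans (Finset.dvd_prod_of_mem _
    (Finset.mem_range_succ_iff.2 (Polynomial.le_natDegree_of_ne_zero hj)))

theorem monom_add (f g : Fin n → ℕ[X]) :
    monom σK (f + g) = monom σK f * monom σK g := by
  simp only [monom, Pi.add_apply, ypow_add, Finset.prod_mul_distrib]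

theorem exists_monom_eq (m : Fin n × ℕ →₀ ℕ) :
    ∃ f, (MvPolynomial.monomial m 1 : DPoly K n) = monom σK f := by
  have hzero : (1 : DPoly K n) = monom σK 0 := by simp [monom, ypow_zero]
  induction m using Finsupp.induction_linear with
  | zero => exact ⟨0, by simp [← hzero]⟩
  | add a b ha hb =>
    obtain ⟨f, hf⟩ := ha
    obtain ⟨g, hg⟩ := hb
    exact ⟨f + g, by rw [monom_add, ← hf, ← hg, MvPolynomial.monomial_mul, one_mul]⟩
  | single v c =>
    rw [← MvPolynomial.X_pow_eq_monomial]
    induction c with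
    | zero => exact ⟨0, by rw [pow_zero, hzero]⟩
    | succ c ih =>
      obtain ⟨f, hf⟩ := ih
      refine ⟨f + Pi.single v.1 (X ^ v.2), ?_⟩
      rw [monom_add, ← hf, pow_succ]
      congr 1
      rw [monom, Finset.prod_eq_single v.1]
      · rw [Pi.single_eq_same, ypow_X_pow]
      · intro i _ hi
        rw [Pi.single_eq_of_ne hi, ypow_zero]
      · simp

/-- A ring hom sending each variable `y_i^{x^j}` to the value at `x^j` of a character of `ℤ[x]`
sends `y_i^p` to the value of that character at `p`. -/
theorem map_ypow {S : Type*} [CommRing S] (θ : DPoly K n →+* S)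
    (E : Fin n → Multiplicative ℤ[X] →* S)
    (h : ∀ i j, θ (MvPolynomial.X (i, j)) = E i (.ofAdd (X ^ j))) (i : Fin n) (p : ℕ[X]) :
    θ (ypow σK i p) = E i (.ofAdd (p.map (Nat.castRingHom ℤ))) := by
  rw [ypow_eq_prod σK i p (Nat.lt_succ_self _), map_prod]
  conv_rhs => rw [p.as_sum_range_C_mul_X_pow, Polynomial.map_sum, ofAdd_sum, map_prod]
  refine Finset.prod_congr rfl fun j _ => ?_
  rw [map_pow, h, ← map_pow, ← ofAdd_nsmul]
  simp [nsmul_eq_mul]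

theorem map_monom {S : Type*} [CommRing S] (θ : DPoly K n →+* S)
    (E : Fin n → Multiplicative ℤ[X] →* S)
    (h : ∀ i j, θ (MvPolynomial.X (i, j)) = E i (.ofAdd (X ^ j))) (f : Fin n → ℕ[X]) :
    θ (monom σK f) = ∏ i, E i (.ofAdd ((f i).map (Nat.castRingHom ℤ))) := by
  simp only [monom, map_prod, map_ypow σK θ E h]

theorem coeff_posPart (f : ℤ[X]) (j : ℕ) : (posPart f).coeff j = (f.coeff j).toNat := by
  rw [_root_.posPart.eq_1, Polynomial.sum_def, Polynomial.finsetSum_coeff]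
  simp only [Polynomial.coeff_monomial, Finset.sum_ite_eq']
  split_ifs with h
  · rfl
  · simp [Polynomial.notMem_support_iff.1 h]

theorem coeff_negPart (f : ℤ[X]) (j : ℕ) : (negPart f).coeff j = (-f.coeff j).toNat := by
  rw [_root_.negPart.eq_1, Polynomial.sum_def, Polynomial.finsetSum_coeff]
  simp +contextual [Polynomial.coeff_monomial]

theorem map_posPart_sub_map_negPart (f : ℤ[X]) :
    (posPart f).map (Nat.castRingHom ℤ) - (negPart f).map (Nat.castRingHom ℤ) = f := by
  ext j
  simp only [Polynomial.coeff_sub, Polynomial.coeff_map, coeff_posPart, coeff_negPart,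
    eq_natCast]
  omega

/-- Two monomials whose exponents differ by an element of `L` are congruent modulo `I_L`. -/
theorem monom_sub_monom_mem_latticeIdeal {L : Submodule ℤ[X] (Fin n → ℤ[X])}
    {f g : Fin n → ℕ[X]}
    (h : (fun i => (f i).map (Nat.castRingHom ℤ) - (g i).map (Nat.castRingHom ℤ)) ∈ L) :
    monom σK f - monom σK g ∈ latticeIdeal σK L := by
  set d : Fin n → ℤ[X] :=
    fun i => (f i).map (Nat.castRingHom ℤ) - (g i).map (Nat.castRingHom ℤ) with hd
  set c : Fin n → ℕ[X] := fun i =>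
    posPart ((f i).map (Nat.castRingHom ℤ) - (posPart (d i)).map (Nat.castRingHom ℤ)) with hc
  have hf : f = c + fun i => posPart (d i) := by
    ext i j
    simp only [hc, hd, Pi.add_apply, Polynomial.coeff_add, coeff_posPart, Polynomial.coeff_sub,
      Polynomial.coeff_map, eq_natCast]
    omega
  have hg : g = c + fun i => negPart (d i) := by
    ext i j
    simp only [hc, hd, Pi.add_apply, Polynomial.coeff_add, coeff_posPart, coeff_negPart,
      Polynomial.coeff_sub, Polynomial.coeff_map, eq_natCast]
    omega
  have hmem : monom σK (fun i => posPart (d i)) - monom σK (fun i => negPart (d i)) ∈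
      latticeIdeal σK L := subset_sigmaIdealGen (shift σK) _ ⟨d, h, rfl⟩
  have heq : monom σK f - monom σK g =
      monom σK c * (monom σK (fun i => posPart (d i)) - monom σK (fun i => negPart (d i))) := by
    rw [mul_sub, ← monom_add, ← monom_add, ← hf, ← hg]
  rw [heq]
  exact Ideal.mul_mem_left _ _ hmem

end Monomials

section Toric

variable (K : Type*) [Field K] {n : ℕ} (σK : K →+* K) (w : Fin n → ℤ[X])

/-- The `K`-algebra map `K{y_1,…,y_n} → K[ℤ[x]]` sending `Y^f` to the basis element
at `Σ f_i w_i`. -/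
noncomputable def toricMap : DPoly K n →ₐ[K] AddMonoidAlgebra K ℤ[X] :=
  MvPolynomial.aeval fun v => AddMonoidAlgebra.single (X ^ v.2 * w v.1) 1

variable {K}

theorem toricMap_monom (f : Fin n → ℕ[X]) :
    toricMap K w (monom σK f) =
      AddMonoidAlgebra.single (∑ i, (f i).map (Nat.castRingHom ℤ) * w i) 1 := by
  have h := map_monom σK (toricMap K w : DPoly K n →+* AddMonoidAlgebra K ℤ[X])
    (fun i => (AddMonoidAlgebra.of K ℤ[X]).comp
      (AddMonoidHom.toMultiplicative (AddMonoidHom.mulRight (w i))))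
    (fun i j => by simp [toricMap]) f
  rw [RingHom.coe_coe] at h
  rw [h]
  simp only [MonoidHom.comp_apply]
  rw [← map_prod, AddMonoidAlgebra.of_apply, toAdd_prod]
  rfl

/-- The difference operator on `K[ℤ[x]]`: it multiplies exponents by `x`. -/
noncomputable def groupAlgebraShift : AddMonoidAlgebra K ℤ[X] →+* AddMonoidAlgebra K ℤ[X] :=
  (AddMonoidAlgebra.mapDomainRingHom K (AddMonoidHom.mulLeft (X : ℤ[X]))).comp
    (AddMonoidAlgebra.mapRingHom ℤ[X] σK)

theorem groupAlgebraShift_injective : Function.Injective (groupAlgebraShift σK) := by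
  have h₁ := AddMonoidAlgebra.mapDomain_injective (R := K)
    (f := AddMonoidHom.mulLeft (X : ℤ[X])) (mul_right_injective₀ Polynomial.X_ne_zero)
  have h₂ := AddMonoidAlgebra.map_injective (M := ℤ[X]) (σK : K →+ K) σK.injective
  exact h₁.comp h₂

theorem toricMap_shift (a : DPoly K n) :
    toricMap K w (shift σK a) = groupAlgebraShift σK (toricMap K w a) := by
  suffices h : ((toricMap K w : DPoly K n →+* AddMonoidAlgebra K ℤ[X]).comp (shift σK)) =
      (groupAlgebraShift σK).comp (toricMap K w : DPoly K n →+* AddMonoidAlgebra K ℤ[X]) from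
    RingHom.congr_fun h a
  refine MvPolynomial.ringHom_ext (fun r => ?_) fun v => ?_
  · simp [shift, toricMap, groupAlgebraShift]
  · simp [shift, toricMap, groupAlgebraShift, pow_succ', mul_assoc]

instance : UniqueSums ℤ[X] :=
  UniqueSums.of_injective_addHom
    (⟨fun p => p.coeff, fun p q => funext (Polynomial.coeff_add p q)⟩ : ℤ[X] →ₙ+ (ℕ → ℤ))
    Polynomial.coeff_injective inferInstance

theorem isSigmaPrime_ker_toricMap : IsSigmaPrime (shift σK) (RingHom.ker (toricMap K w)) := by
  refine ⟨fun a ha => ?_, fun a ha => ?_, RingHom.ker_isPrime _⟩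
  · rw [RingHom.mem_ker] at ha ⊢
    rw [toricMap_shift, ha, map_zero]
  · rw [RingHom.mem_ker] at ha ⊢
    rw [toricMap_shift] at ha
    exact groupAlgebraShift_injective σK (ha.trans (map_zero _).symm)

theorem sum_sub_mul_eq (f g : Fin n → ℤ[X]) :
    ∑ i, (f i - g i) * w i = ∑ i, f i * w i - ∑ i, g i * w i := by
  simp only [sub_mul, Finset.sum_sub_distrib]

/-- If `L` is the kernel of `f ↦ Σ f_i w_i`, then `I_L` is the kernel of the toric map. -/
theorem latticeIdeal_eq_ker_toricMap {L : Submodule ℤ[X] (Fin n → ℤ[X])}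
    (hL : ∀ f, f ∈ L ↔ ∑ i, f i * w i = 0) :
    latticeIdeal σK L = RingHom.ker (toricMap K w) := by
  refine le_antisymm (sigmaIdealGen_le ?_ (isSigmaPrime_ker_toricMap σK w).1) fun q hq => ?_
  · rintro _ ⟨f, hf, rfl⟩
    rw [SetLike.mem_coe, RingHom.mem_ker, map_sub, toricMap_monom, toricMap_monom, sub_eq_zero]
    congr 1
    rw [← sub_eq_zero, ← sum_sub_mul_eq w]
    simpa only [map_posPart_sub_map_negPart] using (hL f).1 hf
  · let mk := Ideal.Quotient.mkₐ K (latticeIdeal σK L)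
    have key : ∀ f g : Fin n → ℕ[X],
        ∑ i, (f i).map (Nat.castRingHom ℤ) * w i = ∑ i, (g i).map (Nat.castRingHom ℤ) * w i →
        mk (monom σK f) = mk (monom σK g) := fun f g hfg => by
      refine Ideal.Quotient.eq.2 (monom_sub_monom_mem_latticeIdeal σK ((hL _).2 ?_))
      rw [sum_sub_mul_eq w, hfg, sub_self]
    obtain ⟨r, hr⟩ : ∃ r : ℤ[X] → DPoly K n ⧸ latticeIdeal σK L, ∀ f : Fin n → ℕ[X],
        r (∑ i, (f i).map (Nat.castRingHom ℤ) * w i) = mk (monom σK f) :=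
      ⟨_, fun f => Function.FactorsThrough.extend_apply (g := fun f => mk (monom σK f))
        (fun f g h => key f g h) 0 f⟩
    let ρ : AddMonoidAlgebra K ℤ[X] →ₗ[K] DPoly K n ⧸ latticeIdeal σK L :=
      (Finsupp.linearCombination K r).comp (AddMonoidAlgebra.coeffLinearEquiv K).toLinearMap
    have hρ : ρ.comp (toricMap K w).toLinearMap = mk.toLinearMap := by
      refine MvPolynomial.basisMonomials (Fin n × ℕ) K |>.ext fun m => ?_
      obtain ⟨f, hf⟩ := exists_monom_eq (n := n) σK m
      rw [MvPolynomial.coe_basisMonomials]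
      beta_reduce
      rw [hf]
      simp only [LinearMap.comp_apply, AlgHom.toLinearMap_apply, toricMap_monom, ← hr, ρ]
      simp [AddMonoidAlgebra.coeffLinearEquiv]
    have hq' := LinearMap.congr_fun hρ q
    simp only [LinearMap.comp_apply, AlgHom.toLinearMap_apply] at hq'
    rw [RingHom.mem_ker.1 hq, map_zero] at hq'
    exact Ideal.Quotient.eq_zero_iff_mem.1 hq'.symm

end Toric

section PrimeIdeals

variable {K : Type*} [Field K] {n : ℕ} (σK : K →+* K)

/-- The character of `ℤ[x]` sending `x^j` to `u j`. -/
noncomputable def polynomialCharacter {G : Type*} [CommGroup G] (u : ℕ → G) :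
    ℤ[X] →+ Additive G :=
  AddMonoidHom.mk' (fun p => p.sum fun j c => c • Additive.ofMul (u j)) fun p q =>
    Polynomial.sum_add_index p q _ (fun _ => zero_smul _ _) fun _ _ _ => add_smul _ _ _

theorem polynomialCharacter_X_pow {G : Type*} [CommGroup G] (u : ℕ → G) (j : ℕ) :
    polynomialCharacter u (X ^ j) = Additive.ofMul (u j) := by
  simp [polynomialCharacter, ← Polynomial.monomial_one_right_eq_X_pow,
    Polynomial.sum_monomial_index]

theorem IsSigmaIdeal.iterate_mem {R : Type*} [CommRing R] {σ : R →+* R} {I : Ideal R}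
    (hI : IsSigmaIdeal σ I) {a : R} (ha : a ∈ I) (k : ℕ) : σ^[k] a ∈ I := by
  induction k with
  | zero => exact ha
  | succ k ih =>
    rw [Function.iterate_succ_apply']
    exact hI _ ih

theorem map_iterate_shift_monom {F : Type*} [CommRing F] (θ : DPoly K n →+* F)
    (u : Fin n × ℕ → Fˣ) (hu : ∀ v, θ (MvPolynomial.X v) = u v) (j : ℕ) (f : Fin n → ℕ[X]) :
    θ ((shift σK)^[j] (monom σK f)) =
      ((∑ i, polynomialCharacter (fun k => u (i, k))
        (X ^ j * (f i).map (Nat.castRingHom ℤ))).toMul : Fˣ) := by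
  have h := map_monom σK (θ.comp (shift σK ^ j))
    (fun i => (Units.coeHom F).comp (AddMonoidHom.toMultiplicativeLeft
      ((polynomialCharacter fun k => u (i, k)).comp (AddMonoidHom.mulLeft (X ^ j : ℤ[X])))))
    (fun i k => by
      rw [RingHom.comp_apply, RingHom.coe_pow, shift_iterate_X, hu]
      change _ = (((polynomialCharacter (fun k => u (i, k)) (X ^ j * X ^ k)).toMul : Fˣ) : F)
      rw [← pow_add, polynomialCharacter_X_pow, add_comm, toMul_ofMul]) f
  rw [RingHom.comp_apply, RingHom.coe_pow] at h
  rw [h, toMul_sum, Units.coe_prod]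
  rfl

theorem map_iterate_shift_monom_sub_monom_eq_zero_iff {F : Type*} [CommRing F]
    (θ : DPoly K n →+* F) (u : Fin n × ℕ → Fˣ) (hu : ∀ v, θ (MvPolynomial.X v) = u v) (j : ℕ)
    (f g : Fin n → ℕ[X]) :
    θ ((shift σK)^[j] (monom σK f - monom σK g)) = 0 ↔
      ∑ i, polynomialCharacter (fun k => u (i, k)) (X ^ j * ((f i).map (Nat.castRingHom ℤ) -
        (g i).map (Nat.castRingHom ℤ))) = 0 := by
  rw [← RingHom.coe_pow, map_sub, map_sub, RingHom.coe_pow,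
    map_iterate_shift_monom σK θ u hu, map_iterate_shift_monom σK θ u hu, sub_eq_zero,
    Units.val_inj, Equiv.apply_eq_iff_eq, ← sub_eq_zero, ← Finset.sum_sub_distrib]
  simp only [mul_sub, map_sub]

/-- A prime σ-ideal which contains the binomial `Y^f - Y^g` but no variable contains the lattice
ideal of the lattice generated by `f - g`. -/
theorem latticeIdeal_span_le_of_X_notMem {P : Ideal (DPoly K n)} [P.IsPrime]
    (hP : IsSigmaIdeal (shift σK) P) (hX : ∀ v, MvPolynomial.X v ∉ P) {f g : Fin n → ℕ[X]}
    (hfg : monom σK f - monom σK g ∈ P) :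
    latticeIdeal σK (Submodule.span ℤ[X]
      {fun i => (f i).map (Nat.castRingHom ℤ) - (g i).map (Nat.castRingHom ℤ)}) ≤ P := by
  obtain ⟨F, _, θ, hθ⟩ : ∃ (F : Type _) (_ : Field F) (θ : DPoly K n →+* F),
      ∀ a, θ a = 0 ↔ a ∈ P :=
    ⟨P.ResidueField, inferInstance, algebraMap _ _, fun _ => Ideal.algebraMap_residueField_eq_zero⟩
  let u : Fin n × ℕ → Fˣ := fun v => Units.mk0 (θ (MvPolynomial.X v)) ((hθ _).not.2 (hX v))
  have hmem : ∀ (j : ℕ) (a b : Fin n → ℕ[X]),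
      (shift σK)^[j] (monom σK a - monom σK b) ∈ P ↔
        ∑ i, polynomialCharacter (fun k => u (i, k))
          (X ^ j * ((a i).map (Nat.castRingHom ℤ) - (b i).map (Nat.castRingHom ℤ))) = 0 :=
    fun j a b => (hθ _).symm.trans
      (map_iterate_shift_monom_sub_monom_eq_zero_iff σK θ u (fun _ => rfl) j a b)
  refine sigmaIdealGen_le ?_ hP
  rintro _ ⟨h, hh, rfl⟩
  obtain ⟨p, rfl⟩ := Submodule.mem_span_singleton.1 hh
  refine (hmem 0 _ _).2 ?_
  simp only [pow_zero, one_mul, map_posPart_sub_map_negPart, Pi.smul_apply, smul_eq_mul]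
  induction p using Polynomial.induction_on' with
  | add p q hp hq =>
    simp only [add_mul, map_add, Finset.sum_add_distrib]
    rw [hp (Submodule.mem_span_singleton.2 ⟨p, rfl⟩),
      hq (Submodule.mem_span_singleton.2 ⟨q, rfl⟩), add_zero]
  | monomial j c =>
    have := (hmem j f g).1 (hP.iterate_mem hfg j)
    rw [← smul_zero c, ← this, Finset.smul_sum]
    refine Finset.sum_congr rfl fun i _ => ?_
    rw [← map_zsmul, ← Polynomial.C_mul_X_pow_eq_monomial, mul_assoc,
      Polynomial.smul_eq_C_mul]

theorem exists_coeff_pos_of_eval_one_eq_zero {f : ℤ[X]} (hf : f ≠ 0) (h : f.eval 1 = 0) :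
    ∃ j, 0 < f.coeff j := by
  by_contra! H
  rw [Polynomial.eval_eq_sum, Polynomial.sum_def] at h
  simp only [one_pow, mul_one] at h
  rw [Finset.sum_eq_zero_iff_of_nonpos fun j _ => H j] at h
  obtain ⟨j, hj⟩ := Polynomial.support_nonempty.2 hf
  exact Polynomial.mem_support_iff.1 hj (h j hj)

theorem monom_mem_of_coeff_ne_zero {I : Ideal (DPoly K n)} {f : Fin n → ℕ[X]} {i : Fin n} {j : ℕ}
    (hj : (f i).coeff j ≠ 0) (hI : MvPolynomial.X (i, j) ∈ I) : monom σK f ∈ I :=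
  I.mem_of_dvd ((X_dvd_ypow σK i hj).trans (Finset.dvd_prod_of_mem _ (Finset.mem_univ i))) hI

/-- An ideal containing all variables `y_i^{x^j}` for a fixed `i` contains the binomials attached
to every nonzero multiple of a vector whose `i`-th entry is nonzero and vanishes at `1`. -/
theorem latticeIdeal_span_le_of_X_mem {P : Ideal (DPoly K n)} (hP : IsSigmaIdeal (shift σK) P)
    {i : Fin n} (hX : ∀ j, MvPolynomial.X (i, j) ∈ P) {v : Fin n → ℤ[X]} (hv : v i ≠ 0)
    (hv1 : (v i).eval 1 = 0) : latticeIdeal σK (Submodule.span ℤ[X] {v}) ≤ P := by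
  refine sigmaIdealGen_le ?_ hP
  rintro _ ⟨h, hh, rfl⟩
  obtain ⟨p, rfl⟩ := Submodule.mem_span_singleton.1 hh
  rcases eq_or_ne p 0 with rfl | hp
  · simp [_root_.posPart.eq_1, _root_.negPart.eq_1]
  · have hne : (p • v) i ≠ 0 := mul_ne_zero hp hv
    have hev : ((p • v) i).eval 1 = 0 := by simp [hv1]
    obtain ⟨j, hj⟩ := exists_coeff_pos_of_eval_one_eq_zero hne hev
    obtain ⟨k, hk⟩ := exists_coeff_pos_of_eval_one_eq_zero (neg_ne_zero.2 hne) (by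
      rw [Polynomial.eval_neg, hev, neg_zero])
    rw [Polynomial.coeff_neg] at hk
    refine P.sub_mem (monom_mem_of_coeff_ne_zero σK (i := i) (j := j) ?_ (hX j))
      (monom_mem_of_coeff_ne_zero σK (i := i) (j := k) ?_ (hX k))
    · rw [coeff_posPart]
      omega
    · rw [coeff_negPart]
      omega

end PrimeIdeals

section Example

variable {K : Type*} [Field K] (σK : K →+* K)

theorem mem_span_iff_dual_eq_zero (f : Fin 2 → ℤ[X]) :
    f ∈ Submodule.span ℤ[X] {![(X : ℤ[X]) ^ 2 + 1 - X, (X : ℤ[X]) - 1]} ↔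
      ∑ i, f i * ![(X : ℤ[X]) - 1, -(X ^ 2 + 1 - X)] i = 0 := by
  rw [Submodule.mem_span_singleton, Fin.sum_univ_two]
  simp only [Matrix.cons_val_zero, Matrix.cons_val_one]
  constructor
  · rintro ⟨p, rfl⟩
    simp only [Pi.smul_apply, smul_eq_mul, Matrix.cons_val_zero, Matrix.cons_val_one]
    ring
  · intro h
    refine ⟨f 0 - X * f 1, ?_⟩
    ext1 i
    fin_cases i
    · simp only [Pi.smul_apply, smul_eq_mul, Fin.zero_eta, Matrix.cons_val_zero]
      linear_combination X * h
    · simp only [Pi.smul_apply, smul_eq_mul, Fin.mk_one, Matrix.cons_val_one,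
        Matrix.cons_val_fin_one]
      linear_combination h

/-- A prime σ-ideal containing `y_1^{x^3+1} y_2^{x^2} - y_2` and some variable contains all the
variables `y_2^{x^j}`. -/
theorem X_one_mem_of_X_mem {P : Ideal (DPoly K 2)} [P.IsPrime]
    (hP : IsSigmaIdeal (shift σK) P)
    (hmem : ypow σK 0 (X ^ 3 + 1) * ypow σK 1 (X ^ 2) - ypow σK 1 1 ∈ P)
    {v : Fin 2 × ℕ} (hv : MvPolynomial.X v ∈ P) (j : ℕ) :
    (MvPolynomial.X (1, j) : DPoly K 2) ∈ P := by
  have hrel : ∀ k, (MvPolynomial.X (0, 3 + k) * MvPolynomial.X (0, k) *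
      MvPolynomial.X (1, 2 + k) - MvPolynomial.X (1, k) : DPoly K 2) ∈ P := fun k => by
    have h := hP.iterate_mem hmem k
    rw [← pow_zero (X : ℕ[X]), ypow_add] at h
    rw [← RingHom.coe_pow] at h
    simpa only [ypow_X_pow, map_sub, map_mul, RingHom.coe_pow, shift_iterate_X, zero_add] using h
  have hstep : ∀ k, (MvPolynomial.X (1, k) : DPoly K 2) ∈ P → MvPolynomial.X (1, k + 1) ∈ P :=
    fun k hk => by simpa only [shift_X] using hP _ hk
  have hback : ∀ k, (MvPolynomial.X (1, k) : DPoly K 2) ∈ P → MvPolynomial.X (1, 0) ∈ P := by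
    intro k
    induction k with
    | zero => exact id
    | succ k ih =>
      intro hk
      refine ih ((P.sub_mem_iff_right (P.mul_mem_left _ ?_)).1 (hrel k))
      rw [add_comm]
      exact hstep _ hk
  have hzero : (MvPolynomial.X (1, 0) : DPoly K 2) ∈ P := by
    obtain ⟨i, k⟩ := v
    fin_cases i
    · exact hback k ((P.sub_mem_iff_right
        (P.mul_mem_right _ (P.mul_mem_left _ hv))).1 (hrel k))
    · exact hback k hv
  induction j with
  | zero => exact hzero
  | succ j ih => exact hstep j ih

end Example

/-- For `L = (x²+1−x, x−1) ⊆ ℤ[x]²`, `I_L` is σ-prime and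
`I_L = ⟨y_1^{x²+1} y_2^x − y_1^x y_2, y_1^{x³+1} y_2^{x²} − y_2⟩_r`. -/
theorem stmt16 {K : Type*} [Field K] [CharZero K] (σK : K →+* K)
    (L : Submodule (Polynomial ℤ) (Fin 2 → Polynomial ℤ))
    (hL : L = Submodule.span (Polynomial ℤ)
      {![(Polynomial.X : Polynomial ℤ) ^ 2 + 1 - Polynomial.X,
         (Polynomial.X : Polynomial ℤ) - 1]}) :
    IsSigmaPrime (shift σK) (latticeIdeal σK L) ∧
    latticeIdeal σK L = rwmClosure (shift σK)
      {ypow σK 0 (Polynomial.X ^ 2 + 1) * ypow σK 1 Polynomial.X -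
        ypow σK 0 Polynomial.X * ypow σK 1 1,
       ypow σK 0 (Polynomial.X ^ 3 + 1) * ypow σK 1 (Polynomial.X ^ 2) -
        ypow σK 1 1} := by
  subst hL
  set I := latticeIdeal σK (Submodule.span ℤ[X]
    {![(X : ℤ[X]) ^ 2 + 1 - X, (X : ℤ[X]) - 1]}) with hI
  have hprime : IsSigmaPrime (shift σK) I := by
    rw [hI, latticeIdeal_eq_ker_toricMap σK _ mem_span_iff_dual_eq_zero]
    exact isSigmaPrime_ker_toricMap σK _
  refine ⟨hprime, le_antisymm (le_rwmClosure fun P hP hσ hF => ?_) (hprime.rwmClosure_le ?_)⟩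
  · rw [Set.insert_subset_iff, Set.singleton_subset_iff] at hF
    by_cases hv : ∃ v, (MvPolynomial.X v : DPoly K 2) ∈ P
    · obtain ⟨v, hv⟩ := hv
      exact latticeIdeal_span_le_of_X_mem σK hσ (X_one_mem_of_X_mem σK hσ hF.2 hv)
        (by simpa using Polynomial.X_sub_C_ne_zero (1 : ℤ)) (by simp)
    · push Not at hv
      convert latticeIdeal_span_le_of_X_notMem σK hσ hv
        (f := ![X ^ 2 + 1, X]) (g := ![X, 1]) ?_ using 4
      · ext1 i
        fin_cases i <;> simp
      · simpa [monom, Fin.prod_univ_two] using hF.1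
  · rw [Set.insert_subset_iff, Set.singleton_subset_iff]
    constructor
    · have h := monom_sub_monom_mem_latticeIdeal σK (f := ![X ^ 2 + 1, X]) (g := ![X, 1])
        ((mem_span_iff_dual_eq_zero _).2 (by simp [Fin.sum_univ_two]; ring))
      simpa [monom, Fin.prod_univ_two] using h
    · have h := monom_sub_monom_mem_latticeIdeal σK (f := ![X ^ 3 + 1, X ^ 2]) (g := ![0, 1])
        ((mem_span_iff_dual_eq_zero _).2 (by simp [Fin.sum_univ_two]; ring))
      simpa [monom, Fin.prod_univ_two, ypow_zero] using h
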